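/- If R is von Neumann regular, i.e., for every a ∈ R there exists b ∈ R with a·b·a = a, then for any morphism f : K → X in D(R) between perfect objects such that the induced map H_n(f) : H_n(K) → H_n(X) is zero for every n ∈ ℤ, the morphism f is zero in D(R). -/

import Mathlib

open CategoryTheory Limits Pretriangulated Opposite

universe w u

variable (R : Type u) [Ring R] [HasDerivedCategory.{w} (ModuleCat.{u} R)]

/-- The derived category `D(R)` of the category of `R`-modules. -/
noncomputable abbrev DR := DerivedCategory (ModuleCat.{u} R)

/-- `R[n]`, the `n`-fold shift of the complex consisting of `R` concentrated in degree `0`. -/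
noncomputable def Rsph (n : ℤ) : DR R :=
  ((DerivedCategory.singleFunctor (ModuleCat.{u} R) 0).obj (ModuleCat.of R R))⟦n⟧

/-- The `n`-th homology module `H_n(X)` of an object `X` of `D(R)` (with homological
indexing, so that `H_n = H^{-n}` cohomologically and `H_n(R[n]) = R`). -/
noncomputable def Hmod (n : ℤ) : DR R ⥤ ModuleCat.{u} R :=
  DerivedCategory.homologyFunctor (ModuleCat.{u} R) (-n)

/-- A class of objects in `D(R)` is *thick-closed* if it is closed under isomorphisms,
shifts, retracts, and completion of distinguished triangles (two-out-of-three). -/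
def IsThickClosed (P : Set (DR R)) : Prop :=
  (∀ X Y : DR R, (X ≅ Y) → X ∈ P → Y ∈ P) ∧
  (∀ (X : DR R) (n : ℤ), X ∈ P → X⟦n⟧ ∈ P) ∧
  (∀ (X Y : DR R) (i : X ⟶ Y) (r : Y ⟶ X), i ≫ r = 𝟙 X → Y ∈ P → X ∈ P) ∧
  (∀ Tr : Triangle (DR R), Tr ∈ (distTriang (DR R)) →
    ((Tr.obj₁ ∈ P → Tr.obj₂ ∈ P → Tr.obj₃ ∈ P) ∧
     (Tr.obj₂ ∈ P → Tr.obj₃ ∈ P → Tr.obj₁ ∈ P) ∧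
     (Tr.obj₁ ∈ P → Tr.obj₃ ∈ P → Tr.obj₂ ∈ P)))

/-- An object of `D(R)` is *perfect* if it lies in the thick subcategory generated by `R`,
i.e. if it belongs to every thick-closed class of objects containing `R[n]` for all `n`. -/
def IsPerfect (X : DR R) : Prop :=
  ∀ P : Set (DR R), (∀ n : ℤ, Rsph R n ∈ P) → IsThickClosed R P → X ∈ P


theorem vnr_aux {R : Type*} [Ring R] (hvnr : ∀ a : R, ∃ b : R, a * b * a = a)
    {ι : Type*} (x : ι →₀ R) (s : Finset ι) :
    ∃ φ : (ι →₀ R) →ₗ[R] R, ∀ k ∈ s, φ x * x k = x k := by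
  classical
  induction s using Finset.induction_on with
  | empty => exact ⟨0, by simp⟩
  | insert a s ha ih =>
    obtain ⟨φ, hφ⟩ := ih
    obtain ⟨b, hb⟩ := hvnr (x a - φ x * x a)
    refine ⟨φ + (LinearMap.toSpanSingleton R R (b * (1 - φ x))).comp
      (Finsupp.lapply a - (LinearMap.toSpanSingleton R R (x a)).comp φ), ?_⟩
    intro k hk
    have key : ∀ y : R, (φ x + (x a - φ x * x a) * (b * (1 - φ x))) * y =
        φ x * y + (x a - φ x * x a) * b * (y - φ x * y) := by
      intro y; noncomm_ring
    rcases Finset.mem_insert.1 hk with rfl | hk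
    · simp only [LinearMap.add_apply, LinearMap.comp_apply, LinearMap.sub_apply,
        LinearMap.toSpanSingleton_apply, Finsupp.lapply_apply, smul_eq_mul, key, hb]
      abel
    · simp only [LinearMap.add_apply, LinearMap.comp_apply, LinearMap.sub_apply,
        LinearMap.toSpanSingleton_apply, Finsupp.lapply_apply, smul_eq_mul, key, hφ k hk]
      simp

theorem vnr_reg {R : Type*} [Ring R] (hvnr : ∀ a : R, ∃ b : R, a * b * a = a)
    {N : Type*} [AddCommGroup N] [Module R N] [Module.Projective R N] (x : N) :
    ∃ φ : N →ₗ[R] R, φ x • x = x := by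
  obtain ⟨i, hi⟩ := Module.projective_def'.1 (inferInstance : Module.Projective R N)
  obtain ⟨φ, hφ⟩ := vnr_aux hvnr (i x) (i x).support
  have h : φ (i x) • i x = i x := by
    ext k
    by_cases hk : k ∈ (i x).support
    · simpa using hφ k hk
    · simp [Finsupp.notMem_support_iff.1 hk]
  refine ⟨φ.comp i, ?_⟩
  have := congrArg (Finsupp.linearCombination R id) h
  have h2 := LinearMap.congr_fun hi x
  simp only [LinearMap.comp_apply, LinearMap.id_apply] at h2
  simpa [h2] using this

theorem vnr_proj {R : Type*} [Ring R] (hvnr : ∀ a : R, ∃ b : R, a * b * a = a)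
    {N : Type*} [AddCommGroup N] [Module R N] [Module.Projective R N]
    (S : Submodule R N) (hS : S.FG) :
    ∃ p : N →ₗ[R] N, (∀ x, p x ∈ S) ∧ ∀ x ∈ S, p x = x := by
  classical
  obtain ⟨s, rfl⟩ := hS
  induction s using Finset.induction_on with
  | empty => exact ⟨0, by simp⟩
  | insert a s ha ih =>
    obtain ⟨p, hp1, hp2⟩ := ih
    obtain ⟨φ, hφ⟩ := vnr_reg hvnr (a - p a)
    have hle : Submodule.span R (s : Set N) ≤ Submodule.span R (insert a s : Finset N) :=
      Submodule.span_mono (by simp)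
    have ha' : a ∈ Submodule.span R ((insert a s : Finset N) : Set N) :=
      Submodule.subset_span (by simp)
    let p' := p + (LinearMap.toSpanSingleton R N (a - p a)).comp (φ.comp (LinearMap.id - p))
    have hp' : ∀ x, p' x = p x + φ (x - p x) • (a - p a) := fun x => by simp [p']
    refine ⟨p', fun x => ?_, fun x hx => ?_⟩
    · rw [hp']
      exact add_mem (hle (hp1 _)) (Submodule.smul_mem _ _ (sub_mem ha' (hle (hp1 _))))
    · have : Submodule.span R ((insert a s : Finset N) : Set N) ≤
          LinearMap.eqLocus p' LinearMap.id := by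
        rw [Submodule.span_le]
        intro y hy
        rw [SetLike.mem_coe, LinearMap.mem_eqLocus, hp']
        rcases Finset.mem_insert.1 (Finset.mem_coe.1 hy) with rfl | hy
        · rw [hφ]; simp
        · rw [hp2 y (Submodule.subset_span hy)]; simp
      exact this hx

theorem vnr_exact {R : Type*} [Ring R] (hvnr : ∀ a : R, ∃ b : R, a * b * a = a)
    {A B C D E : Type*} [AddCommGroup A] [Module R A] [AddCommGroup B] [Module R B]
    [AddCommGroup C] [Module R C] [AddCommGroup D] [Module R D] [AddCommGroup E] [Module R E]
    [Module.Finite R A] [Module.Finite R B] [Module.Finite R D]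
    [Module.Projective R B] [Module.Projective R D] [Module.Projective R E]
    (f : A →ₗ[R] B) (g : B →ₗ[R] C) (h : C →ₗ[R] D) (k : D →ₗ[R] E)
    (h1 : LinearMap.range f = LinearMap.ker g) (h2 : LinearMap.range g = LinearMap.ker h)
    (h3 : LinearMap.range h = LinearMap.ker k) :
    Module.Finite R C ∧ Module.Projective R C := by
  -- `range k` is projective
  obtain ⟨q, hq1, hq2⟩ := vnr_proj hvnr (LinearMap.range k)
    (Module.Finite.iff_fg.1 inferInstance)
  have pk : Module.Projective R (LinearMap.range k) :=
    Module.Projective.of_split (LinearMap.range k).subtype (q.codRestrict _ hq1)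
      (by ext x; simp [hq2 x.1 x.2])
  obtain ⟨t, ht⟩ := Module.projective_lifting_property k.rangeRestrict LinearMap.id
    k.surjective_rangeRestrict
  have ht' : ∀ y, k (t y) = y := fun y => congrArg Subtype.val (LinearMap.congr_fun ht y)
  -- retraction of `D` onto `range h`
  let π : D →ₗ[R] LinearMap.range h :=
    (LinearMap.id - t.comp k.rangeRestrict).codRestrict _ (fun d => by
      rw [h3, LinearMap.mem_ker]; simp [ht'])
  have hπ : ∀ x : LinearMap.range h, π x = x := by
    intro x
    have hx : k x.1 = 0 := by
      exact LinearMap.mem_ker.1 (h3.le x.2)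
    have hx' : k.rangeRestrict x.1 = 0 := Subtype.ext hx
    apply Subtype.ext
    simp [π, hx']
  have ph : Module.Projective R (LinearMap.range h) :=
    Module.Projective.of_split (LinearMap.range h).subtype π (by ext x; simp [hπ])
  have fh : Module.Finite R (LinearMap.range h) :=
    Module.Finite.of_surjective π (fun x => ⟨x, hπ x⟩)
  obtain ⟨σ, hσ⟩ := Module.projective_lifting_property h.rangeRestrict LinearMap.id
    h.surjective_rangeRestrict
  have hσ' : ∀ y, h (σ y) = y := fun y => congrArg Subtype.val (LinearMap.congr_fun hσ y)
  -- `range g` is projective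
  obtain ⟨p, hp1, hp2⟩ := vnr_proj hvnr (LinearMap.range f)
    (Module.Finite.iff_fg.1 inferInstance)
  have pg : Module.Projective R (LinearMap.range g) := by
    refine Module.Projective.of_split
      (((LinearMap.ker g).liftQ (LinearMap.id - p) (fun x hx => ?_)).comp
        g.quotKerEquivRange.symm.toLinearMap) g.rangeRestrict ?_
    · rw [← h1] at hx
      simp [hp2 x hx]
    · ext x
      obtain ⟨x, b, rfl⟩ := x
      have e : g.quotKerEquivRange.symm ⟨g b, b, rfl⟩ = (LinearMap.ker g).mkQ b := by
        rw [LinearEquiv.symm_apply_eq]; rfl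
      have : g (p b) = 0 := by
        have := hp1 b
        rw [h1] at this
        exact this
      simp [e, this]
  rw [h2] at pg
  have fk : Module.Finite R (LinearMap.ker h) := by rw [← h2]; infer_instance
  let s : (LinearMap.ker h × LinearMap.range h) →ₗ[R] C :=
    (LinearMap.ker h).subtype.coprod σ
  let i : C →ₗ[R] (LinearMap.ker h × LinearMap.range h) :=
    LinearMap.prod ((LinearMap.id - σ.comp h.rangeRestrict).codRestrict _ (fun c => by
      simp [hσ'])) h.rangeRestrict
  have hsi : s.comp i = LinearMap.id := by
    ext c; simp [s, i]
  exact ⟨Module.Finite.of_surjective s (fun c => ⟨i c, LinearMap.congr_fun hsi c⟩),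
    Module.Projective.of_split i s hsi⟩

section CatPart

open CategoryTheory Limits HomologicalComplex

variable {C : Type*} [Category* C] [Abelian C]

/-- The complex with zero differential on the homology of `K`. -/
noncomputable def zeroCx (K : CochainComplex C ℤ) : CochainComplex C ℤ where
  X n := K.homology n
  d _ _ := 0

/-- The splitting map. -/
noncomputable def zeroCxMap (K : CochainComplex C ℤ) (s : ∀ n, K.homology n ⟶ K.cycles n) :
    zeroCx K ⟶ K where
  f n := s n ≫ K.iCycles n
  comm' i j _ := by simp [zeroCx]

theorem quasiIso_aux (Z K : CochainComplex C ℤ) (hd : ∀ i j, Z.d i j = 0) (t : Z ⟶ K)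
    (c : ∀ n, Z.X n ≅ K.homology n) (s : ∀ n, K.homology n ⟶ K.cycles n)
    (hs : ∀ n, s n ≫ K.homologyπ n = 𝟙 _)
    (ht : ∀ n, t.f n = (c n).hom ≫ s n ≫ K.iCycles n) : QuasiIso t := by
  rw [quasiIso_iff]
  intro n
  rw [quasiIsoAt_iff_isIso_homologyMap]
  have i1 : IsIso (Z.iCycles n) := Z.isIso_iCycles n _ rfl (hd _ _)
  have i2 : IsIso (Z.homologyπ n) := Z.isIso_homologyπ _ n rfl (hd _ _)
  have h1 : cyclesMap t n = Z.iCycles n ≫ (c n).hom ≫ s n := by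
    rw [← cancel_mono (K.iCycles n)]
    simp [ht]
  have h2 : Z.homologyπ n ≫ homologyMap t n = Z.iCycles n ≫ (c n).hom := by
    rw [homologyπ_naturality, h1]
    simp [hs]
  have h3 : homologyMap t n = inv (Z.homologyπ n) ≫ Z.iCycles n ≫ (c n).hom := by
    rw [← h2, IsIso.inv_hom_id_assoc]
  rw [h3]
  infer_instance

theorem zeroCxMap_quasiIso (K : CochainComplex C ℤ) (s : ∀ n, K.homology n ⟶ K.cycles n)
    (hs : ∀ n, s n ≫ K.homologyπ n = 𝟙 _) : QuasiIso (zeroCxMap K s) :=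
  quasiIso_aux _ _ (fun _ _ => rfl) _ (fun n => Iso.refl (K.homology n)) s hs
    (fun n => (Category.id_comp (s n ≫ K.iCycles n)).symm)

theorem homotopy_of_zero (Z L : CochainComplex C ℤ) (hd : ∀ i j, Z.d i j = 0)
    [∀ n, Projective (Z.X n)] (g : Z ⟶ L) (hg : ∀ n, homologyMap g n = 0) :
    Nonempty (Homotopy g 0) := by
  have key : ∀ i j, (ComplexShape.up ℤ).Rel j i → ∃ h : Z.X i ⟶ L.X j, h ≫ L.d j i = g.f i := by
    intro i j hij
    have i1 : IsIso (Z.iCycles i) := Z.isIso_iCycles i _ rfl (hd _ _)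
    have hz : (inv (Z.iCycles i) ≫ cyclesMap g i) ≫ L.homologyπ i = 0 := by
      rw [Category.assoc, ← homologyπ_naturality, hg]; simp
    have ex : (ShortComplex.mk (L.toCycles j i) (L.homologyπ i) (by simp)).Exact :=
      ShortComplex.exact_of_g_is_cokernel _
        (L.homologyIsCokernel j i ((ComplexShape.up ℤ).prev_eq' hij))
    refine ⟨ex.liftFromProjective _ hz, ?_⟩
    have := ex.liftFromProjective_comp _ hz
    dsimp at this
    rw [← L.toCycles_i j i, reassoc_of% this]
    simp
  choose h hh using key
  have : g = Homotopy.nullHomotopicMap' h := by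
    ext n
    rw [Homotopy.nullHomotopicMap'_f (k₂ := n - 1) (k₀ := n + 1) (by simp) (by simp), hh, hd]
    simp
  rw [this]
  exact ⟨Homotopy.nullHomotopy' h⟩

theorem ghost_zero [HasDerivedCategory C] (K X : DerivedCategory C)
    (hp : ∀ n, Projective ((DerivedCategory.homologyFunctor C n).obj K))
    (N : ℤ) (hN : ∀ n, N < n → IsZero ((DerivedCategory.homologyFunctor C n).obj K))
    (f : K ⟶ X) (hf : ∀ n, (DerivedCategory.homologyFunctor C n).map f = 0) : f = 0 := by
  let K' := DerivedCategory.Q.objPreimage K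
  let eK : DerivedCategory.Q.obj K' ≅ K := DerivedCategory.Q.objObjPreimageIso K
  let L := DerivedCategory.Q.objPreimage X
  let eL : DerivedCategory.Q.obj L ≅ X := DerivedCategory.Q.objObjPreimageIso X
  let e : ∀ n, K'.homology n ≅ (DerivedCategory.homologyFunctor C n).obj K := fun n =>
    ((DerivedCategory.homologyFunctorFactors C n).app K').symm ≪≫
      (DerivedCategory.homologyFunctor C n).mapIso eK
  have hp' : ∀ n, Projective (K'.homology n) := fun n => Projective.of_iso (e n).symm (hp n)
  have hs : ∀ n, ∃ s : K'.homology n ⟶ K'.cycles n, s ≫ K'.homologyπ n = 𝟙 _ := fun n =>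
    ⟨Projective.factorThru (𝟙 _) (K'.homologyπ n), Projective.factorThru_comp _ _⟩
  choose s hs using hs
  have q := zeroCxMap_quasiIso K' s hs
  have : ∀ n, Projective ((zeroCx K').X n) := hp'
  have : (zeroCx K').IsStrictlyLE N := by
    rw [CochainComplex.isStrictlyLE_iff]
    exact fun i hi => (hN i hi).of_iso (e i)
  have : (zeroCx K').IsKProjective := CochainComplex.isKProjective_of_projective _ N
  let φ : DerivedCategory.Q.obj (zeroCx K') ⟶ DerivedCategory.Q.obj L :=
    DerivedCategory.Q.map (zeroCxMap K' s) ≫ eK.hom ≫ f ≫ eL.inv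
  obtain ⟨g', hg'⟩ := (CochainComplex.IsKProjective.Qh_map_bijective (zeroCx K') 
    ((HomotopyCategory.quotient _ _).obj L)).surjective
    ((DerivedCategory.quotientCompQhIso C).hom.app _ ≫ φ ≫
      (DerivedCategory.quotientCompQhIso C).inv.app _)
  obtain ⟨g, rfl⟩ := (HomotopyCategory.quotient _ _).map_surjective g'
  have hg : DerivedCategory.Q.map g = φ := by
    have := DerivedCategory.quotientCompQhIso_hom_naturality g
    rw [hg'] at this
    rw [← cancel_epi ((DerivedCategory.quotientCompQhIso C).hom.app _), ← this]
    simp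
  have hφ : ∀ n, (DerivedCategory.homologyFunctor C n).map φ = 0 := fun n => by
    simp [φ, hf]
  have hgn : ∀ n, homologyMap g n = 0 := fun n => by
    have := DerivedCategory.homologyFunctorFactors_hom_naturality g n
    rw [hg, hφ, zero_comp] at this
    exact (cancel_epi ((DerivedCategory.homologyFunctorFactors C n).hom.app (zeroCx K'))).1
      (this.symm.trans comp_zero.symm)
  obtain ⟨H⟩ := homotopy_of_zero (zeroCx K') L (fun _ _ => rfl) g hgn
  have h0 : φ = 0 := by
    rw [← hg, DerivedCategory.Q_map_eq_of_homotopy _ H, Functor.map_zero]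
  have : f = inv (DerivedCategory.Q.map (zeroCxMap K' s) ≫ eK.hom) ≫ φ ≫ eL.hom := by
    simp [φ]
  rw [this, h0]
  simp

end CatPart

/-- good modules -/
def FGProj (R : Type u) [Ring R] (M : ModuleCat.{u} R) : Prop :=
  Module.Finite R M ∧ Module.Projective R M

theorem FGProj.of_retract {R : Type u} [Ring R] {M N : ModuleCat.{u} R} (i : M ⟶ N) (r : N ⟶ M)
    (h : i ≫ r = 𝟙 M) (hN : FGProj R N) : FGProj R M := by
  obtain ⟨h1, h2⟩ := hN
  have h' : r.hom.comp i.hom = LinearMap.id := by rw [← ModuleCat.hom_comp, h]; rfl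
  exact ⟨Module.Finite.of_surjective r.hom (fun c => ⟨i.hom c, LinearMap.congr_fun h' c⟩),
    Module.Projective.of_split i.hom r.hom h'⟩

/-- good objects -/
def GoodObj (R : Type u) [Ring R] [HasDerivedCategory.{w} (ModuleCat.{u} R)] : Set (DR R) :=
  fun X => (∀ n : ℤ, FGProj R ((DerivedCategory.homologyFunctor _ n).obj X)) ∧
    ∃ N : ℤ, ∀ n, N < n → IsZero ((DerivedCategory.homologyFunctor _ n).obj X)

theorem GoodObj.of_retract {R : Type u} [Ring R] [HasDerivedCategory.{w} (ModuleCat.{u} R)]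
    {X Y : DR R} (i : X ⟶ Y) (r : Y ⟶ X) (h : i ≫ r = 𝟙 X) (hY : Y ∈ GoodObj R) :
    X ∈ GoodObj R := by
  obtain ⟨h1, N, hN⟩ := hY
  have h' : ∀ n, (DerivedCategory.homologyFunctor _ n).map i ≫
      (DerivedCategory.homologyFunctor _ n).map r = 𝟙 _ := fun n => by
    rw [← Functor.map_comp, h, CategoryTheory.Functor.map_id]
  refine ⟨fun n => FGProj.of_retract _ _ (h' n) (h1 n), N, fun n hn => ?_⟩
  rw [IsZero.iff_id_eq_zero, ← h', (hN n hn).eq_of_tgt ((DerivedCategory.homologyFunctor _ n).map i) 0,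
    zero_comp]

theorem GoodObj.shift {R : Type u} [Ring R] [HasDerivedCategory.{w} (ModuleCat.{u} R)]
    {X : DR R} (a : ℤ) (hX : X ∈ GoodObj R) : X⟦a⟧ ∈ GoodObj R := by
  obtain ⟨h1, N, hN⟩ := hX
  let e : ∀ n, (DerivedCategory.homologyFunctor (ModuleCat.{u} R) n).obj (X⟦a⟧) ≅
      (DerivedCategory.homologyFunctor _ (a + n)).obj X := fun n =>
    ((DerivedCategory.homologyFunctor (ModuleCat.{u} R) 0).shiftIso a n (a + n) rfl).app X
  exact ⟨fun n => FGProj.of_retract (e n).hom (e n).inv (e n).hom_inv_id (h1 _), N - a,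
    fun n hn => (hN (a + n) (by lia)).of_iso (e n)⟩

theorem GoodObj.third {R : Type u} [Ring R] [HasDerivedCategory.{w} (ModuleCat.{u} R)]
    (hvnr : ∀ a : R, ∃ b : R, a * b * a = a)
    (T : Triangle (DR R)) (hT : T ∈ distTriang (DR R)) (h1 : T.obj₁ ∈ GoodObj R)
    (h2 : T.obj₂ ∈ GoodObj R) : T.obj₃ ∈ GoodObj R := by
  obtain ⟨h1, N, hN⟩ := h1
  obtain ⟨h2, M, hM⟩ := h2
  refine ⟨fun n => ?_, max N M, fun n hn => ?_⟩
  · obtain ⟨_, _⟩ := h1 n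
    obtain ⟨_, _⟩ := h2 n
    obtain ⟨_, _⟩ := h1 (n + 1)
    obtain ⟨_, _⟩ := h2 (n + 1)
    exact vnr_exact hvnr _ _ _ _
      (DerivedCategory.HomologySequence.exact₂ T hT n).moduleCat_range_eq_ker
      (DerivedCategory.HomologySequence.exact₃ T hT n (n + 1)).moduleCat_range_eq_ker
      (DerivedCategory.HomologySequence.exact₁ T hT n (n + 1)).moduleCat_range_eq_ker
  · exact (DerivedCategory.HomologySequence.exact₃ T hT n (n + 1)).isZero_of_both_zeros
      ((hM n (lt_of_le_of_lt (le_max_right _ _) hn)).eq_of_src _ _)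
      ((hN (n + 1) (by have := le_max_left N M; lia)).eq_of_tgt _ _)

theorem GoodObj.single {R : Type u} [Ring R] [HasDerivedCategory.{w} (ModuleCat.{u} R)] :
    (DerivedCategory.singleFunctor (ModuleCat.{u} R) 0).obj (ModuleCat.of R R) ∈ GoodObj R := by
  let e : ∀ n, (DerivedCategory.homologyFunctor (ModuleCat.{u} R) n).obj
      ((DerivedCategory.singleFunctor (ModuleCat.{u} R) 0).obj (ModuleCat.of R R)) ≅
      ((HomologicalComplex.single (ModuleCat.{u} R) (ComplexShape.up ℤ) 0).obj
        (ModuleCat.of R R)).homology n := fun n =>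
    (DerivedCategory.homologyFunctorFactors (ModuleCat.{u} R) n).app _
  have hz : ∀ n : ℤ, n ≠ 0 → IsZero ((DerivedCategory.homologyFunctor (ModuleCat.{u} R) n).obj
      ((DerivedCategory.singleFunctor (ModuleCat.{u} R) 0).obj (ModuleCat.of R R))) := fun n hn =>
    (HomologicalComplex.isZero_single_obj_homology _ _ _ _ hn).of_iso (e n)
  have hR : FGProj R (ModuleCat.of R R) := ⟨Module.Finite.self R, inferInstanceAs (Module.Projective R R)⟩
  refine ⟨fun n => ?_, 0, fun n hn => hz n (by lia)⟩
  by_cases hn : n = 0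
  · subst hn
    let e' := e 0 ≪≫ HomologicalComplex.singleObjHomologySelfIso (ComplexShape.up ℤ) 0
      (ModuleCat.of R R)
    exact FGProj.of_retract e'.hom e'.inv e'.hom_inv_id hR
  · exact FGProj.of_retract (N := ModuleCat.of R R) 0 0 ((hz n hn).eq_of_src _ _) hR

theorem GoodObj.thick {R : Type u} [Ring R] [HasDerivedCategory.{w} (ModuleCat.{u} R)]
    (hvnr : ∀ a : R, ∃ b : R, a * b * a = a) : IsThickClosed R (GoodObj R) := by
  refine ⟨fun X Y e h => GoodObj.of_retract e.inv e.hom e.inv_hom_id h,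
    fun X n h => GoodObj.shift n h, fun X Y i r h hY => GoodObj.of_retract i r h hY,
    fun T hT => ⟨GoodObj.third hvnr T hT, fun h2 h3 => ?_, fun h1 h3 => ?_⟩⟩
  · have h := GoodObj.shift (-1) (GoodObj.third hvnr _ (rot_of_distTriang _ hT) h2 h3)
    let e := (shiftFunctorCompIsoId (DR R) (1 : ℤ) (-1) (by simp)).app T.obj₁
    exact GoodObj.of_retract e.inv e.hom e.inv_hom_id h
  · exact GoodObj.third hvnr _ (inv_rot_of_distTriang _ hT) (GoodObj.shift (-1) h3) h1

/-- if `R` is von Neumann regular (for every `a ∈ R` there is `b ∈ R` with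
`a·b·a = a`), then any morphism between perfect objects of `D(R)` inducing zero on all
homology modules is zero in `D(R)`. -/
theorem freyd_derivedCategory_of_vonNeumannRegular
    (hvnr : ∀ a : R, ∃ b : R, a * b * a = a)
    (K X : DR R) (hK : IsPerfect R K) (hX : IsPerfect R X)
    (f : K ⟶ X) (hf : ∀ n : ℤ, (Hmod R n).map f = 0) :
    f = 0 := by
  obtain ⟨h1, N, hN⟩ := hK (GoodObj R) (fun n => GoodObj.shift n GoodObj.single)
    (GoodObj.thick hvnr)
  refine ghost_zero K X (fun n => ?_) N hN f (fun n => ?_)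
  · have := (h1 n).2
    exact ModuleCat.projective_of_categoryTheory_projective _
  · have := hf (-n)
    rwa [Hmod, neg_neg] at this
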